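/- arXiv:1605.02845 — 4 statements merged into one kernel-verified Lean document; each statement's English description precedes it below -/
import Mathlib

section
/- Let H : ℝ^{2n} → ℝ, let ∇̄H : ℝ^{2n} × ℝ^{2n} → ℝ^{2n} satisfy the discrete gradient energy identity ∇̄H(z,z')ᵀ(z'−z) = H(z') − H(z), and let J be the canonical symplectic matrix J = [[0, I_n],[−I_n, 0]]. Suppose z, z' ∈ ℝ^{2n}, h ≠ 0, Lagrange multipliers λ_α ∈ ℝ and vectors μ^α ∈ ℝ^n (m+1 ≤ α ≤ n) satisfy (z'−z)/h = J ∇̄H(z,z') + Σ_α λ_α (0, μ^α) together with the discrete constraint conditions ∇̄H(z,z')ᵀ (0, μ^α) = 0 for each α. Then H(z') = H(z). -/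
open Matrix

/-- A skew-symmetric real matrix has vanishing quadratic form. -/
theorem dotProduct_mulVec_self_eq_zero_of_transpose_eq_neg {ι : Type*} [Fintype ι]
    {A : Matrix ι ι ℝ} (hA : Aᵀ = -A) (v : ι → ℝ) : v ⬝ᵥ A *ᵥ v = 0 := by
  have hskew : v ⬝ᵥ A *ᵥ v = -(v ⬝ᵥ A *ᵥ v) := by
    conv_lhs => rw [dotProduct_mulVec, ← mulVec_transpose, hA, neg_mulVec, neg_dotProduct,
      dotProduct_comm]
  linarith

/-- The direct energy-preserving integrator on `T*Q ≅ ℝ^{2n}`: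
if `(z'-z)/h = J ∇̄H(z,z') + Σ_α λ_α (0, μ^α)` with `J` the canonical symplectic matrix,
`∇̄H` satisfying the discrete gradient energy identity, and the discrete constraint
conditions `∇̄H(z,z')ᵀ(0, μ^α) = 0` hold, then `H(z') = H(z)`. -/
theorem direct_discrete_gradient_integrator_preserves_energy {n k : ℕ}
    (H : ((Fin n ⊕ Fin n) → ℝ) → ℝ)
    (Dg : ((Fin n ⊕ Fin n) → ℝ) → ((Fin n ⊕ Fin n) → ℝ) → ((Fin n ⊕ Fin n) → ℝ))
    (hDg : ∀ z z', Dg z z' ⬝ᵥ (z' - z) = H z' - H z)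
    (J : Matrix (Fin n ⊕ Fin n) (Fin n ⊕ Fin n) ℝ)
    (hJ : J = Matrix.fromBlocks 0 1 (-1) 0)
    (z z' : (Fin n ⊕ Fin n) → ℝ) (h : ℝ) (hh : h ≠ 0)
    (lam : Fin k → ℝ) (μ : Fin k → (Fin n → ℝ))
    (hstep : h⁻¹ • (z' - z) = J.mulVec (Dg z z') + ∑ α, lam α • Sum.elim (0 : Fin n → ℝ) (μ α))
    (hconstr : ∀ α, Dg z z' ⬝ᵥ Sum.elim (0 : Fin n → ℝ) (μ α) = 0) :
    H z' = H z := by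
  have hskew : Jᵀ = -J := by
    simp [hJ, fromBlocks_transpose, fromBlocks_neg]
  have hzero : h⁻¹ * (H z' - H z) = 0 := by
    rw [← hDg, ← smul_eq_mul, ← dotProduct_smul, hstep, dotProduct_add,
      dotProduct_mulVec_self_eq_zero_of_transpose_eq_neg hskew, dotProduct_sum]
    simp [dotProduct_smul, hconstr]
  exact sub_eq_zero.mp ((mul_eq_zero.mp hzero).resolve_left (inv_ne_zero hh))
end

section
/- Let C ∈ ℝ, h ∈ ℝ, and suppose (ρ₁, ρ₂) and (ρ₁', ρ₂') ∈ ℝ² satisfy the discrete Chaplygin sleigh momentum update ρ₁' = ρ₁ − (h/4) C (ρ₁+ρ₁')(ρ₂+ρ₂') and ρ₂' = ρ₂ + (h/4) C (ρ₁+ρ₁')². Then the energy is exactly preserved: ρ₁'² + ρ₂'² = ρ₁² + ρ₂². -/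
/-- The discrete Chaplygin sleigh momentum update
`ρ₁' = ρ₁ - (h/4)C(ρ₁+ρ₁')(ρ₂+ρ₂')`, `ρ₂' = ρ₂ + (h/4)C(ρ₁+ρ₁')²` exactly preserves the
energy: `ρ₁'² + ρ₂'² = ρ₁² + ρ₂²`. -/
theorem discrete_chaplygin_sleigh_energy_preserved (C h ρ₁ ρ₂ ρ₁' ρ₂' : ℝ)
    (h1 : ρ₁' = ρ₁ - (h / 4) * C * (ρ₁ + ρ₁') * (ρ₂ + ρ₂'))
    (h2 : ρ₂' = ρ₂ + (h / 4) * C * (ρ₁ + ρ₁') ^ 2) :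
    ρ₁' ^ 2 + ρ₂' ^ 2 = ρ₁ ^ 2 + ρ₂ ^ 2 := by
  linear_combination (ρ₁ + ρ₁') * h1 + (ρ₂ + ρ₂') * h2
end

section
/- Let C ∈ ℝ, b ∈ ℝ, h₀ ∈ ℝ with 2 + h₀ C b ≠ 0. Suppose f, g are real-valued functions defined and differentiable on a neighborhood of the point p = (0, b, h₀) ∈ ℝ³, with f(p) = 0, g(p) = b, and satisfying on that neighborhood the implicit equations f(ρ₁,ρ₂,h) − ρ₁ + (h/4)C(ρ₁ + f(ρ₁,ρ₂,h))(ρ₂ + g(ρ₁,ρ₂,h)) = 0 and g(ρ₁,ρ₂,h) − ρ₂ − (h/4)C(ρ₁ + f(ρ₁,ρ₂,h))² = 0. Then the Jacobian of (f, g) with respect to (ρ₁, ρ₂) at p is diagonal: ∂f/∂ρ₁(p) = (2 − h₀Cb)/(2 + h₀Cb), ∂f/∂ρ₂(p) = 0, ∂g/∂ρ₁(p) = 0, ∂g/∂ρ₂(p) = 1. -/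
/-- If `f, g` are the locally defined update maps of the implicit
discrete Chaplygin sleigh momentum scheme near the equilibrium point `p = (0, b, h₀)`
(with `2 + h₀Cb ≠ 0`), then the Jacobian of `(f, g)` with respect to `(ρ₁, ρ₂)` at `p`
is diagonal with entries `(2 - h₀Cb)/(2 + h₀Cb)` and `1`. -/
theorem discrete_chaplygin_sleigh_jacobian (C b h₀ : ℝ) (hden : 2 + h₀ * C * b ≠ 0)
    (f g : ℝ × ℝ × ℝ → ℝ)
    (hf : ∀ᶠ q in nhds ((0, b, h₀) : ℝ × ℝ × ℝ), DifferentiableAt ℝ f q)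
    (hg : ∀ᶠ q in nhds ((0, b, h₀) : ℝ × ℝ × ℝ), DifferentiableAt ℝ g q)
    (hf0 : f (0, b, h₀) = 0) (hg0 : g (0, b, h₀) = b)
    (heq1 : ∀ᶠ q in nhds ((0, b, h₀) : ℝ × ℝ × ℝ),
      f q - q.1 + (q.2.2 / 4) * C * (q.1 + f q) * (q.2.1 + g q) = 0)
    (heq2 : ∀ᶠ q in nhds ((0, b, h₀) : ℝ × ℝ × ℝ),
      g q - q.2.1 - (q.2.2 / 4) * C * (q.1 + f q) ^ 2 = 0) :
    fderiv ℝ f (0, b, h₀) (1, 0, 0) = (2 - h₀ * C * b) / (2 + h₀ * C * b) ∧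
    fderiv ℝ f (0, b, h₀) (0, 1, 0) = 0 ∧
    fderiv ℝ g (0, b, h₀) (1, 0, 0) = 0 ∧
    fderiv ℝ g (0, b, h₀) (0, 1, 0) = 1 := by
  have hF := hf.self_of_nhds.hasFDerivAt
  have hG := hg.self_of_nhds.hasFDerivAt
  set F := fderiv ℝ f (0, b, h₀)
  set G := fderiv ℝ g (0, b, h₀)
  have h1 : HasFDerivAt (fun q : ℝ × ℝ × ℝ => q.1)
      (ContinuousLinearMap.fst ℝ ℝ (ℝ × ℝ)) (0, b, h₀) := hasFDerivAt_fst
  have hs : HasFDerivAt (fun q : ℝ × ℝ × ℝ => q.2)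
      (ContinuousLinearMap.snd ℝ ℝ (ℝ × ℝ)) (0, b, h₀) := hasFDerivAt_snd
  have h2 := hs.fst
  have hc := (hs.snd.mul_const (4⁻¹ : ℝ)).mul_const C
  have hlin1 (v : ℝ × ℝ × ℝ) : F v - v.1 + h₀ / 4 * C * (v.1 + F v) * (b + b) = 0 := by
    have hd := (hF.sub h1).add ((hc.mul (h1.add hF)).mul (h2.add hG))
    have hz := hd.unique ((hasFDerivAt_const (0 : ℝ) _).congr_of_eventuallyEq
      (heq1.mono fun q hq => by simpa [div_eq_mul_inv] using hq))
    have hv := DFunLike.congr_fun hz v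
    simp [hf0, hg0] at hv
    linear_combination hv
  have hlin2 (v : ℝ × ℝ × ℝ) : G v - v.2.1 = 0 := by
    have hd := (hG.sub h2).sub (hc.mul ((h1.add hF).pow 2))
    have hz := hd.unique ((hasFDerivAt_const (0 : ℝ) _).congr_of_eventuallyEq
      (heq2.mono fun q hq => by simpa [div_eq_mul_inv] using hq))
    have hv := DFunLike.congr_fun hz v
    simp [hf0] at hv
    linear_combination hv
  refine ⟨?_, ?_, ?_, ?_⟩
  · rw [eq_div_iff hden]
    linear_combination 2 * hlin1 (1, 0, 0)
  · refine (mul_eq_zero.mp ?_).resolve_left hden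
    linear_combination 2 * hlin1 (0, 1, 0)
  · exact sub_eq_zero.mp (hlin2 (1, 0, 0))
  · exact sub_eq_zero.mp (hlin2 (0, 1, 0))
end

section
/- Let I₁₁, I₂₂ > 0, C¹, C² ∈ ℝ and h ∈ ℝ. Suppose (ρ₁, ρ₂) and (ρ₁', ρ₂') ∈ ℝ² satisfy the implicit midpoint discretization of the Euler–Poincaré–Suslov equations: (ρ₁' − ρ₁)/h = −K (ρ₂' + ρ₂)/(2 I₂₂) and (ρ₂' − ρ₂)/h = K (ρ₁' + ρ₁)/(2 I₁₁), where K := C¹ (ρ₁' + ρ₁)/2 + C² (ρ₂' + ρ₂)/2. Then the energy is exactly preserved: ρ₁'²/I₁₁ + ρ₂'²/I₂₂ = ρ₁²/I₁₁ + ρ₂²/I₂₂. -/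
/-- The implicit midpoint (discrete gradient) discretization of the
Euler–Poincaré–Suslov equations on `so(3)`,
`(ρ₁' - ρ₁)/h = -K(ρ₂' + ρ₂)/(2I₂₂)`, `(ρ₂' - ρ₂)/h = K(ρ₁' + ρ₁)/(2I₁₁)` with
`K = C¹(ρ₁' + ρ₁)/2 + C²(ρ₂' + ρ₂)/2`, exactly preserves the energy
`ρ₁²/I₁₁ + ρ₂²/I₂₂`. -/
theorem suslov_implicit_midpoint_energy_preserved (I₁₁ I₂₂ : ℝ)
    (hI₁ : 0 < I₁₁) (hI₂ : 0 < I₂₂) (c1 c2 h ρ₁ ρ₂ ρ₁' ρ₂' : ℝ) (hh : h ≠ 0)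
    (h1 : (ρ₁' - ρ₁) / h
        = -(c1 * (ρ₁' + ρ₁) / 2 + c2 * (ρ₂' + ρ₂) / 2) * ((ρ₂' + ρ₂) / (2 * I₂₂)))
    (h2 : (ρ₂' - ρ₂) / h
        = (c1 * (ρ₁' + ρ₁) / 2 + c2 * (ρ₂' + ρ₂) / 2) * ((ρ₁' + ρ₁) / (2 * I₁₁))) :
    ρ₁' ^ 2 / I₁₁ + ρ₂' ^ 2 / I₂₂ = ρ₁ ^ 2 / I₁₁ + ρ₂ ^ 2 / I₂₂ := by
  rw [div_eq_iff hh] at h1 h2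
  linear_combination (ρ₁' + ρ₁) / I₁₁ * h1 + (ρ₂' + ρ₂) / I₂₂ * h2
end
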